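/- For every T > 0 there exist positive constants c₁ and c₂ such that for all t ∈ (0,T] and all x, y ∈ D, the series defining G(x,y,t) converges and |G(x,y,t)| ≤ c₁ t^{−d/4} exp(−c₂ |x−y|^{4/3} t^{−1/3}). -/

import Mathlib

open MeasureTheory Real Set

noncomputable section

/-- The spatial domain `D = (0,π)^d` as a subset of Euclidean space. -/
def domD (d : ℕ) : Set (EuclideanSpace ℝ (Fin d)) :=
  {x | ∀ i, x i ∈ Set.Ioo (0 : ℝ) π}

/-- One-dimensional normalized cosine functions: `ε_0 = 1/√π`, `ε_j(x) = √(2/π) cos(jx)`. -/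
def eps1 (j : ℕ) (x : ℝ) : ℝ :=
  if j = 0 then 1 / Real.sqrt π else Real.sqrt (2 / π) * Real.cos (j * x)

/-- The product functions `ε_k(x) = ∏ i, ε_{k i}(x i)` for a multi-index `k ∈ ℕ^d`. -/
def epsk {d : ℕ} (k : Fin d → ℕ) (x : EuclideanSpace ℝ (Fin d)) : ℝ :=
  ∏ i, eps1 (k i) (x i)

/-- The eigenvalue `λ_k = ∑ i, k_i²`. -/
def lam {d : ℕ} (k : Fin d → ℕ) : ℝ := ∑ i, (k i : ℝ) ^ 2

/-- The Green's function of `−Δ²+Δ` with homogeneous Neumann boundary conditions on `D`: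
`G(x,y,t) = ∑_{k∈ℕ^d} e^{−(λ_k²+λ_k)t} ε_k(x) ε_k(y)`. -/
def green {d : ℕ} (x y : EuclideanSpace ℝ (Fin d)) (t : ℝ) : ℝ :=
  ∑' k : Fin d → ℕ, Real.exp (-(lam k ^ 2 + lam k) * t) * epsk k x * epsk k y


/-- Contour shift for entire 1-periodic functions. -/
lemma shift_integral (F : ℂ → ℂ) (hF : Differentiable ℂ F) (hp : ∀ s, F (s + 1) = F s) (w : ℝ) :
    ∫ x in (0:ℝ)..1, F x = ∫ x in (0:ℝ)..1, F (x + w * Complex.I) := by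
  have h := Complex.integral_boundary_rect_eq_zero_of_differentiableOn F 0 (1 + w * Complex.I)
    hF.differentiableOn
  simp only [Complex.zero_re, Complex.zero_im, Complex.add_re, Complex.one_re, Complex.mul_re,
    Complex.ofReal_re, Complex.I_re, Complex.ofReal_im, Complex.I_im, Complex.add_im,
    Complex.one_im, Complex.mul_im, mul_zero, mul_one, sub_zero, add_zero, zero_add, zero_mul,
    Complex.ofReal_zero, Complex.ofReal_one] at h
  have h2 : ∀ y : ℝ, F (1 + y * Complex.I) = F (y * Complex.I) := by
    intro y; rw [add_comm, hp]
  simp only [h2] at h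
  rw [add_sub_assoc, sub_self, add_zero] at h
  exact sub_eq_zero.mp h

lemma periodic_bound (F : ℂ → ℂ) (hF : Differentiable ℂ F) (hp : ∀ s, F (s + 1) = F s)
    (v : ℝ) (hv : 0 < v) (A B : ℝ)
    (hA : ∀ u ∈ Set.Icc (0:ℝ) 1, ‖F (u - v * Complex.I)‖ ≤ A)
    (hB : ∀ u ∈ Set.Icc (0:ℝ) 1, ‖F (u + v * Complex.I)‖ ≤ B) :
    ‖F 0‖ ≤ (A + B * Real.exp (-(2 * π * v))) / (1 - Real.exp (-(2 * π * v))) := by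
  set r := Real.exp (-(2 * π * v)) with hr
  have hr0 : 0 ≤ r := (Real.exp_pos _).le
  have hr1 : r < 1 := by
    rw [hr, Real.exp_lt_one_iff]; have := Real.pi_pos; have := mul_pos this hv; linarith
  have hper : Function.Periodic (fun x : ℝ => F x) 1 := by
    intro x; simp only [Complex.ofReal_add, Complex.ofReal_one, hp]
  have : Fact ((0:ℝ) < 1) := ⟨one_pos⟩
  let f : C(AddCircle (1:ℝ), ℂ) := ⟨hper.lift, by
    refine continuous_coinduced_dom.mpr ?_
    exact hF.continuous.comp Complex.continuous_ofReal⟩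
  have hfx : ∀ x : ℝ, f x = F x := fun x => Function.Periodic.lift_coe hper x
  have hc : ∀ (n : ℤ) (w : ℝ), fourierCoeff f n =
      ∫ x in (0:ℝ)..1, Complex.exp (-(2 * π * Complex.I * n * (x + w * Complex.I))) *
        F (x + w * Complex.I) := by
    intro n w
    rw [fourierCoeff_eq_intervalIntegral f n 0]
    have := shift_integral (fun s => Complex.exp (-(2 * π * Complex.I * n * s)) * F s)
      (by fun_prop) (by
        intro s
        simp only [hp]
        congr 1
        rw [Complex.exp_eq_exp_iff_exists_int]
        exact ⟨-n, by push_cast; ring⟩) w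
    rw [← this]
    simp only [zero_add, div_one, one_smul, smul_eq_mul]
    refine intervalIntegral.integral_congr fun x _ => ?_
    simp only [hfx]
    rw [fourier_coe_apply]
    congr 2
    push_cast; ring
  have hbound : ∀ (n : ℤ) (w C : ℝ), (∀ u ∈ Set.Icc (0:ℝ) 1, ‖F (u + w * Complex.I)‖ ≤ C) →
      ‖fourierCoeff f n‖ ≤ Real.exp (2 * π * n * w) * C := by
    intro n w C hC
    rw [hc n w]
    have := intervalIntegral.norm_integral_le_of_norm_le_const (a := (0:ℝ)) (b := 1)
      (C := Real.exp (2 * π * n * w) * C)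
      (f := fun x : ℝ => Complex.exp (-(2 * π * Complex.I * n * (x + w * Complex.I))) *
        F (x + w * Complex.I)) ?_
    · simpa using this
    · intro x hx
      rw [Set.uIoc_of_le zero_le_one] at hx
      rw [norm_mul, Complex.norm_exp]
      have : (-(2 * π * Complex.I * n * (x + w * Complex.I))).re = 2 * π * n * w := by
        simp
      rw [this]
      exact mul_le_mul_of_nonneg_left (hC x ⟨hx.1.le, hx.2⟩) (Real.exp_pos _).le
  have h1 : ∀ n : ℕ, ‖fourierCoeff f (n:ℤ)‖ ≤ A * r ^ n := by
    intro n
    have := hbound n (-v) A (by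
      intro u hu
      have := hA u hu
      simpa [sub_eq_add_neg] using this)
    rw [hr, ← Real.exp_nat_mul, mul_comm A]
    convert this using 3
    push_cast; ring
  have h2 : ∀ n : ℕ, ‖fourierCoeff f (-((n:ℤ) + 1))‖ ≤ (B * r) * r ^ n := by
    intro n
    have := hbound (-((n:ℤ) + 1)) v B hB
    rw [mul_assoc, ← pow_succ', hr, ← Real.exp_nat_mul, mul_comm B]
    convert this using 3
    push_cast; ring
  have g1 := (hasSum_geometric_of_lt_one hr0 hr1).mul_left A
  have g2 := (hasSum_geometric_of_lt_one hr0 hr1).mul_left (B * r)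
  have s1 : Summable fun n : ℕ => fourierCoeff f (n:ℤ) :=
    Summable.of_norm_bounded g1.summable h1
  have s2 : Summable fun n : ℕ => fourierCoeff f (-((n:ℤ) + 1)) :=
    Summable.of_norm_bounded g2.summable h2
  have s : Summable (fourierCoeff f) := Summable.of_nat_of_neg_add_one s1 s2
  have key := has_pointwise_sum_fourier_series_of_summable s ((0:ℝ) : AddCircle (1:ℝ))
  rw [hfx] at key
  have e : F 0 = ∑' n, fourierCoeff f n := by
    rw [← Complex.ofReal_zero, ← key.tsum_eq]
    refine tsum_congr fun n => ?_
    rw [fourier_coe_apply]; simp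
  rw [e, tsum_of_nat_of_neg_add_one s1 s2]
  refine (norm_add_le _ _).trans ?_
  have b1 := tsum_of_norm_bounded g1 h1
  have b2 := tsum_of_norm_bounded g2 h2
  rw [div_eq_mul_inv, add_mul]
  exact add_le_add b1 b2

/-- The summand of the shifted periodic sum. -/
def fz (t μ z : ℝ) (s : ℂ) : ℂ :=
  Complex.exp (-(t : ℂ) * ((s ^ 2 + μ) ^ 2 + (s ^ 2 + μ)) - Complex.I * s * z)

lemma fz_norm_le {T t μ : ℝ} (z : ℝ) (ht : 0 < t) (htT : t ≤ T) (hμ : 0 ≤ μ) (s : ℂ) :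
    ‖fz t μ z s‖ ≤ (Real.exp T * Real.exp (18 * t * s.im ^ 4) * Real.exp (-(t * μ ^ 2) / 2) *
      Real.exp (s.im * z)) * Real.exp (-(t * s.re ^ 4) / 2) := by
  obtain ⟨u, v⟩ := s
  rw [fz, Complex.norm_exp, ← Real.exp_add, ← Real.exp_add, ← Real.exp_add, ← Real.exp_add,
    Real.exp_le_exp]
  simp [pow_two]
  have h1 : (u * u - v * v + μ) * (u * u - v * v + μ) - (u * v + v * u) * (u * v + v * u)
      ≥ (u ^ 4 + μ ^ 2) / 2 - 17 * v ^ 4 := by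
    nlinarith [sq_nonneg (u ^ 2 + μ - 6 * v ^ 2), mul_nonneg hμ (sq_nonneg u),
      mul_nonneg hμ (sq_nonneg v), sq_nonneg (v ^ 2)]
  have h2 : u * u - v * v + μ ≥ - 1 - v ^ 4 := by
    nlinarith [sq_nonneg u, sq_nonneg (v ^ 2 - 1), sq_nonneg v, sq_nonneg (v^2)]
  have h3 := mul_le_mul_of_nonneg_left (add_le_add h1 h2) ht.le
  nlinarith [h3]

lemma exp_quartic_le {h x R : ℝ} (hh : 0 ≤ h) (n : ℤ) (hx : |x| ≤ R) :
    Real.exp (-(h ^ 4 * (x + n) ^ 4) / 2) ≤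
      Real.exp 1 * Real.exp (h * R) * Real.exp (-h) ^ n.natAbs := by
  rw [← Real.exp_add, ← Real.exp_nat_mul, ← Real.exp_add, Real.exp_le_exp]
  have h1 : (n.natAbs : ℝ) = |(n : ℝ)| := by simp
  rw [h1]
  have h2 : |(n : ℝ)| ≤ |x + n| + R := by
    have : (n : ℝ) = (x + n) - x := by ring
    have h := abs_sub (x + n) x
    rw [← this] at h
    linarith
  have h3 := mul_le_mul_of_nonneg_left h2 hh
  have h4 : ∀ y : ℝ, y ≤ 1 + y ^ 4 / 2 := by
    intro y
    nlinarith [sq_nonneg (y ^ 2 - 1/2), sq_nonneg (y - 1)]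
  have h5 := h4 (h * |x + n|)
  rw [mul_pow, (by decide : Even 4).pow_abs] at h5
  linarith

lemma hasSum_natAbs {r : ℝ} (hr0 : 0 ≤ r) (hr1 : r < 1) :
    HasSum (fun n : ℤ => r ^ n.natAbs) ((1 - r)⁻¹ + r * (1 - r)⁻¹) := by
  have g := hasSum_geometric_of_lt_one hr0 hr1
  refine HasSum.of_nat_of_neg_add_one (f := fun n : ℤ => r ^ n.natAbs) (by simpa using g) ?_
  have := g.mul_left r
  refine this.congr_fun (fun n => ?_)
  have : (-((n:ℤ) + 1)).natAbs = n + 1 := by omega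
  rw [this, pow_succ']

lemma geom_bound {h : ℝ} (hh : 0 < h) :
    (1 - Real.exp (-h))⁻¹ ≤ (1 + h) / h := by
  have : Real.exp (-h) ≤ 1 / (1 + h) := by
    rw [Real.exp_neg, one_div]
    apply inv_anti₀ (by linarith)
    linarith [Real.add_one_le_exp h]
  have h2 : h / (1 + h) ≤ 1 - Real.exp (-h) := by
    have : h / (1 + h) = 1 - 1 / (1 + h) := by field_simp; ring
    linarith
  rw [← inv_div]
  exact inv_anti₀ (by positivity) h2

/-- The constant in the lattice sum bound. -/
def C0 (T R : ℝ) : ℝ := Real.exp 1 * Real.exp (T ^ ((1:ℝ)/4) * R) * (2 * (1 + T ^ ((1:ℝ)/4)))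

lemma C0_pos {T : ℝ} (hT : 0 < T) (R : ℝ) : 0 < C0 T R := by unfold C0; positivity

lemma quarter_pow {t : ℝ} (ht : 0 < t) : (t ^ ((1:ℝ)/4)) ^ 4 = t := by
  rw [← Real.rpow_natCast, ← Real.rpow_mul ht.le]; norm_num

/-- Lattice sum bound: dominated by a summable sequence. -/
lemma lattice {T t R : ℝ} (ht : 0 < t) (htT : t ≤ T) (hR : 0 ≤ R) :
    ∃ (g : ℤ → ℝ) (S : ℝ), HasSum g S ∧ S ≤ C0 T R * t ^ (-(1:ℝ)/4) ∧
      ∀ (n : ℤ) (x : ℝ), |x| ≤ R → Real.exp (-(t * (x + n) ^ 4) / 2) ≤ g n := by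
  set h := t ^ ((1:ℝ)/4) with hh
  have hpos : 0 < h := by positivity
  have hle : h ≤ T ^ ((1:ℝ)/4) := Real.rpow_le_rpow ht.le htT (by norm_num)
  have hr1 : Real.exp (-h) < 1 := by rw [Real.exp_lt_one_iff]; linarith
  have hs := (hasSum_natAbs (Real.exp_pos (-h)).le hr1).mul_left (Real.exp 1 * Real.exp (h * R))
  refine ⟨_, _, hs, ?_, ?_⟩
  · have hinv : t ^ (-(1:ℝ)/4) = h⁻¹ := by
      rw [hh, ← Real.rpow_neg ht.le]; norm_num
    rw [hinv, C0]
    have g := geom_bound hpos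
    have i0 : 0 ≤ (1 - Real.exp (-h))⁻¹ := inv_nonneg.mpr (by linarith)
    have : (1 - Real.exp (-h))⁻¹ + Real.exp (-h) * (1 - Real.exp (-h))⁻¹
        ≤ 2 * (1 + T ^ ((1:ℝ)/4)) * h⁻¹ := by
      calc _ ≤ (1 - Real.exp (-h))⁻¹ + 1 * (1 - Real.exp (-h))⁻¹ := by gcongr
        _ = 2 * (1 - Real.exp (-h))⁻¹ := by ring
        _ ≤ 2 * ((1 + h) / h) := by gcongr
        _ ≤ 2 * ((1 + T ^ ((1:ℝ)/4)) / h) := by gcongr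
        _ = _ := by ring
    rw [mul_assoc (Real.exp 1 * _)]
    gcongr
  · intro n x hx
    have := exp_quartic_le hpos.le n hx
    rwa [hh, quarter_pow ht] at this

/-- The periodized function. -/
def Fz (t μ z : ℝ) (s : ℂ) : ℂ := ∑' n : ℤ, fz t μ z (s + n)

lemma fz_differentiable (t μ z : ℝ) : Differentiable ℂ (fz t μ z) := by
  unfold fz; fun_prop

lemma Fz_differentiable {t μ : ℝ} (z : ℝ) (ht : 0 < t) (hμ : 0 ≤ μ) :
    Differentiable ℂ (Fz t μ z) := by
  intro s0
  set R := ‖s0‖ + 1 with hR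
  have hR0 : 0 ≤ R := by positivity
  obtain ⟨g, S, hg, -, hgb⟩ := lattice (R := R) ht le_rfl hR0
  have := Complex.differentiableOn_tsum_of_summable_norm
    (F := fun (n : ℤ) s => fz t μ z (s + n)) (U := Metric.ball 0 R)
    (u := fun n => (Real.exp t * Real.exp (18 * t * R ^ 4) * 1 *
      Real.exp (R * |z|)) * g n) (hg.summable.mul_left _)
    (fun n => ((fz_differentiable t μ z).comp (by fun_prop)).differentiableOn)
    Metric.isOpen_ball ?_
  · refine this.differentiableAt (Metric.isOpen_ball.mem_nhds ?_)
    simp [hR]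
  · intro n w hw
    have hw' : ‖w‖ ≤ R := by
      rw [Metric.mem_ball, dist_zero_right] at hw; exact hw.le
    have hre : |w.re| ≤ R := (Complex.abs_re_le_norm w).trans hw'
    have him : |w.im| ≤ R := (Complex.abs_im_le_norm w).trans hw'
    refine (fz_norm_le z ht le_rfl hμ (w + n)).trans ?_
    have e1 : (w + n).re = w.re + n := by simp
    have e2 : (w + n).im = w.im := by simp
    rw [e1, e2]
    have b4 : w.im ^ 4 ≤ R ^ 4 := by
      rw [← (by decide : Even 4).pow_abs]; gcongr
    have bz : w.im * z ≤ R * |z| := by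
      calc _ ≤ |w.im * z| := le_abs_self _
        _ = |w.im| * |z| := abs_mul _ _
        _ ≤ _ := by gcongr
    have bm : Real.exp (-(t * μ ^ 2) / 2) ≤ 1 := by
      rw [Real.exp_le_one_iff]; have : 0 ≤ t * μ ^ 2 := by positivity
      linarith
    gcongr
    exact hgb n _ hre

lemma Fz_periodic (t μ z : ℝ) (s : ℂ) : Fz t μ z (s + 1) = Fz t μ z s := by
  unfold Fz
  rw [← (Equiv.addRight (1:ℤ)).tsum_eq (fun n : ℤ => fz t μ z (s + n))]
  refine tsum_congr fun n => ?_
  congr 1; simp; ring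

/-- the main majorant -/
def Mz (T t μ v z : ℝ) : ℝ :=
  Real.exp T * Real.exp (18 * t * v ^ 4) * Real.exp (-(t * μ ^ 2) / 2) *
      Real.exp (v * z) * (C0 T 1 * t ^ (-(1:ℝ)/4))

lemma Fz_norm_le {T t μ : ℝ} (z : ℝ) (ht : 0 < t) (htT : t ≤ T) (hμ : 0 ≤ μ) (s : ℂ)
    (hs : |s.re| ≤ 1) : ‖Fz t μ z s‖ ≤ Mz T t μ s.im z := by
  obtain ⟨g, S, hg, hS, hgb⟩ := lattice (R := 1) ht htT zero_le_one
  have := tsum_of_norm_bounded (f := fun n : ℤ => fz t μ z (s + n))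
    (hg.mul_left (Real.exp T * Real.exp (18 * t * s.im ^ 4) *
      Real.exp (-(t * μ ^ 2) / 2) * Real.exp (s.im * z))) ?_
  · refine this.trans ?_
    unfold Mz
    gcongr
  · intro n
    refine (fz_norm_le z ht htT hμ (s + n)).trans ?_
    have e1 : (s + n).re = s.re + n := by simp
    have e2 : (s + n).im = s.im := by simp
    rw [e1, e2]
    gcongr
    exact hgb n _ hs

lemma fz_summable {t μ : ℝ} (z : ℝ) (ht : 0 < t) (hμ : 0 ≤ μ) :
    Summable fun n : ℤ => fz t μ z n := by
  obtain ⟨g, S, hg, hS, hgb⟩ := lattice (R := 1) ht le_rfl zero_le_one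
  refine Summable.of_norm_bounded (hg.summable.mul_left (Real.exp t * Real.exp (18 * t * 0 ^ 4) *
      Real.exp (-(t * μ ^ 2) / 2) * Real.exp (0 * z))) fun n => ?_
  refine (fz_norm_le z ht le_rfl hμ n).trans ?_
  simp only [Complex.intCast_re, Complex.intCast_im]
  gcongr
  have := hgb n 0 (by simp)
  simpa using this

/-- decay factor -/
def Ez (t δ : ℝ) : ℝ := Real.exp (-((36:ℝ) ^ (-(1:ℝ)/3) / 2) * δ ^ ((4:ℝ)/3) * t ^ (-(1:ℝ)/3))

lemma Fz_zero_bound {T : ℝ} (hT : 0 < T) : ∃ C > 0, ∀ t μ δ z : ℝ, 0 < t → t ≤ T → 0 ≤ μ →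
    0 ≤ δ → δ ≤ z → z ≤ 2 * π - δ →
    ‖Fz t μ z 0‖ ≤ C * t ^ (-(1:ℝ)/4) * Real.exp (-(t * μ ^ 2) / 2) * Ez t δ := by
  have hC0 := C0_pos hT 1
  set K : ℝ := (1 - Real.exp (-(2 * π)))⁻¹ with hK
  have hKpos : 0 < K := by
    rw [hK, inv_pos, sub_pos, Real.exp_lt_one_iff]; have := Real.pi_pos; linarith
  refine ⟨Real.exp T * C0 T 1 * (Real.exp (18 * T) + 2 * K), by positivity, ?_⟩
  intro t μ δ z ht htT hμ hδ hδz hzδ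
  set v : ℝ := (δ / (36 * t)) ^ ((1:ℝ)/3) with hv
  have hv0 : 0 ≤ v := by positivity
  have hv3 : v ^ 3 = δ / (36 * t) := by
    rw [hv, ← Real.rpow_natCast, ← Real.rpow_mul (by positivity)]; norm_num
  have hv4 : 18 * t * v ^ 4 = v * δ / 2 := by
    have : v ^ 4 = v ^ 3 * v := by ring
    rw [this, hv3]; field_simp; ring
  have hE : Ez t δ = Real.exp (-(v * δ / 2)) := by
    unfold Ez
    congr 1
    have h43 : δ ^ ((4:ℝ)/3) = δ ^ ((1:ℝ)/3) * δ := by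
      rcases hδ.eq_or_lt with h | h
      · rw [← h]; rw [Real.zero_rpow (by norm_num)]; simp
      · rw [← Real.rpow_add_one h.ne']; norm_num
    rw [hv, Real.div_rpow hδ (by positivity), Real.mul_rpow (by norm_num) ht.le, h43,
      neg_div, Real.rpow_neg (by norm_num), Real.rpow_neg ht.le]
    field_simp
  have hq : 0 < t ^ (-(1:ℝ)/4) := by positivity
  rw [hE]
  rcases le_or_gt 1 v with h1 | h1
  · have hvpos : 0 < v := by linarith
    have hb := periodic_bound (Fz t μ z) (Fz_differentiable z ht hμ) (Fz_periodic t μ z) v hvpos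
      (Mz T t μ (-v) z) (Mz T t μ v z) (by
        intro u hu
        have := Fz_norm_le z ht htT hμ (u - v * Complex.I)
          (by simpa [abs_of_nonneg hu.1] using hu.2)
        simpa using this) (by
        intro u hu
        have := Fz_norm_le z ht htT hμ (u + v * Complex.I)
          (by simpa [abs_of_nonneg hu.1] using hu.2)
        simpa using this)
    refine hb.trans ?_
    set X := Real.exp T * Real.exp (-(t * μ ^ 2) / 2) * (C0 T 1 * t ^ (-(1:ℝ)/4)) with hX
    have hXpos : 0 < X := by positivity
    have e1 : Mz T t μ (-v) z ≤ X * Real.exp (-(v * δ / 2)) := by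
      have : Mz T t μ (-v) z = X * Real.exp (18 * t * v ^ 4 + -v * z) := by
        rw [Real.exp_add, hX, Mz, (by decide : Even 4).neg_pow]; ring
      rw [this, hv4]
      gcongr
      nlinarith [mul_le_mul_of_nonneg_left hδz hv0]
    have e2 : Mz T t μ v z * Real.exp (-(2 * π * v)) ≤ X * Real.exp (-(v * δ / 2)) := by
      have : Mz T t μ v z * Real.exp (-(2 * π * v))
          = X * Real.exp (18 * t * v ^ 4 + v * z + -(2 * π * v)) := by
        rw [Real.exp_add, Real.exp_add, hX, Mz]; ring
      rw [this, hv4]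
      gcongr
      nlinarith [mul_le_mul_of_nonneg_left hzδ hv0]
    have e3 : (1 - Real.exp (-(2 * π * v)))⁻¹ ≤ K := by
      apply inv_anti₀ (inv_pos.mp hKpos)
      have := Real.pi_pos
      apply sub_le_sub_left
      rw [Real.exp_le_exp]
      nlinarith
    rw [div_eq_mul_inv]
    calc _ ≤ (X * Real.exp (-(v * δ / 2)) + X * Real.exp (-(v * δ / 2))) * K := by
          gcongr
          rw [inv_nonneg, sub_nonneg, Real.exp_le_one_iff]
          have := mul_pos Real.pi_pos hvpos
          linarith
      _ = Real.exp T * C0 T 1 * (2 * K) * t ^ (-(1:ℝ)/4) * Real.exp (-(t * μ ^ 2) / 2) *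
          Real.exp (-(v * δ / 2)) := by rw [hX]; ring
      _ ≤ _ := by
          gcongr
          have := Real.exp_pos (18 * T)
          linarith
  · have hb := Fz_norm_le z ht htT hμ 0 (by simp)
    refine hb.trans ?_
    have e : 1 ≤ Real.exp (18 * T) * Real.exp (-(v * δ / 2)) := by
      rw [← Real.exp_add, Real.one_le_exp_iff, ← hv4]
      have : v ^ 4 ≤ 1 := pow_le_one₀ hv0 h1.le
      nlinarith
    have : Mz T t μ (0:ℂ).im z = Real.exp T * C0 T 1 * t ^ (-(1:ℝ)/4) *
        Real.exp (-(t * μ ^ 2) / 2) * 1 := by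
      rw [Mz]; simp; ring
    rw [this]
    calc _ ≤ Real.exp T * C0 T 1 * t ^ (-(1:ℝ)/4) *
        Real.exp (-(t * μ ^ 2) / 2) * (Real.exp (18 * T) * Real.exp (-(v * δ / 2))) := by gcongr
      _ = Real.exp T * C0 T 1 * Real.exp (18 * T) * t ^ (-(1:ℝ)/4) *
        Real.exp (-(t * μ ^ 2) / 2) * Real.exp (-(v * δ / 2)) := by ring
      _ ≤ _ := by
        gcongr
        linarith

/-- heat factor -/
def az (t μ : ℝ) (j : ℕ) : ℝ := Real.exp (-(((j:ℝ) ^ 2 + μ) ^ 2 + ((j:ℝ) ^ 2 + μ)) * t)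

lemma fz_pair (t μ z : ℝ) (n : ℕ) :
    fz t μ z ((n : ℤ) : ℂ) + fz t μ z ((-(n : ℤ) : ℤ) : ℂ) =
      ((2 * az t μ n * Real.cos (n * z) : ℝ) : ℂ) := by
  unfold fz az
  push_cast
  rw [Complex.cos, sub_eq_add_neg, sub_eq_add_neg, Complex.exp_add, Complex.exp_add, neg_sq]
  have e1 : -(t:ℂ) * (((n:ℂ) ^ 2 + μ) ^ 2 + ((n:ℂ) ^ 2 + μ)) =
    (-(((n:ℂ) ^ 2 + μ) ^ 2 + ((n:ℂ) ^ 2 + μ)) * t) := by ring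
  rw [e1]
  have e2 : -(Complex.I * -(n:ℂ) * z) = n * z * Complex.I := by ring
  have e3 : -(Complex.I * (n:ℂ) * z) = -(n * z) * Complex.I := by ring
  rw [e2, e3]
  ring

lemma cos_hasSum {t μ : ℝ} (z : ℝ) (ht : 0 < t) (hμ : 0 ≤ μ) :
    HasSum (fun n : ℕ => 2 * az t μ n * Real.cos (n * z)) ((Fz t μ z 0).re + az t μ 0) := by
  have h := (fz_summable z ht hμ).hasSum.nat_add_neg
  simp only [fz_pair] at h
  have h2 := Complex.hasSum_re h
  simp only [Complex.ofReal_re] at h2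
  convert h2 using 1
  rw [Complex.add_re]
  congr 1
  · unfold Fz; simp
  · have := fz_pair t μ z 0
    simp only [Nat.cast_zero, neg_zero, zero_mul, Real.cos_zero, mul_one] at this
    have h3 := congrArg Complex.re this
    rw [Complex.add_re, Complex.ofReal_re] at h3
    linarith

lemma eps1_mul (j : ℕ) (x y : ℝ) : eps1 j x * eps1 j y =
    (1 / π) * (Real.cos (j * |x - y|) + Real.cos (j * (x + y))) - (if j = 0 then 1 / π else 0) := by
  have hc : Real.cos (j * |x - y|) = Real.cos (j * (x - y)) := by
    rw [← Real.cos_abs (j * (x - y)), abs_mul, Nat.abs_cast]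
  rw [hc]
  have hπ := Real.pi_pos
  unfold eps1
  split_ifs with h
  · subst h
    have : 1 / √π * (1 / √π) = 1 / π := by
      rw [div_mul_div_comm, Real.mul_self_sqrt hπ.le, one_mul]
    rw [this]; simp; ring
  · have : √(2 / π) * √(2 / π) = 2 / π := Real.mul_self_sqrt (by positivity)
    rw [mul_sub, mul_add (j:ℝ), Real.cos_sub, Real.cos_add]
    linear_combination (Real.cos (j * x) * Real.cos (j * y)) * this

lemma eps1_abs_le (j : ℕ) (x : ℝ) : |eps1 j x| ≤ 1 := by
  have hπ := Real.pi_gt_three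
  unfold eps1
  split_ifs with h
  · rw [abs_of_nonneg (by positivity), div_le_one (by positivity), Real.one_le_sqrt]
    linarith
  · rw [abs_mul, abs_of_nonneg (Real.sqrt_nonneg _)]
    have : √(2 / π) ≤ 1 := by
      rw [Real.sqrt_le_one, div_le_one (by positivity)]; linarith
    exact mul_le_one₀ this (abs_nonneg _) (Real.abs_cos_le_one _)

lemma oneD_hasSum {t μ : ℝ} (x y : ℝ) (ht : 0 < t) (hμ : 0 ≤ μ) :
    HasSum (fun j : ℕ => az t μ j * (eps1 j x * eps1 j y))
      ((1 / (2 * π)) * ((Fz t μ |x - y| 0).re + (Fz t μ (x + y) 0).re)) := by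
  have h1 := ((cos_hasSum |x - y| ht hμ).add (cos_hasSum (x + y) ht hμ)).mul_left (1 / (2 * π))
  have h2 : HasSum (fun j : ℕ => if j = 0 then az t μ 0 * (1 / π) else 0) (az t μ 0 * (1 / π)) :=
    hasSum_ite_eq 0 _
  have h3 := h1.sub h2
  have hπ := Real.pi_pos
  have hv : (1 / (2 * π)) * ((Fz t μ |x - y| 0).re + (Fz t μ (x + y) 0).re) =
      1 / (2 * π) * ((Fz t μ |x - y| 0).re + az t μ 0 + ((Fz t μ (x + y) 0).re + az t μ 0)) -
        az t μ 0 * (1 / π) := by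
    field_simp; ring
  rw [hv]
  refine h3.congr_fun fun j => ?_
  rw [eps1_mul]
  split_ifs with h
  · subst h; field_simp
  · field_simp; ring

lemma oneD_bound {T : ℝ} (hT : 0 < T) : ∃ C > 0, ∀ t μ x y : ℝ, 0 < t → t ≤ T → 0 ≤ μ →
    x ∈ Set.Ioo 0 π → y ∈ Set.Ioo 0 π →
    |∑' j : ℕ, az t μ j * (eps1 j x * eps1 j y)| ≤
      C * t ^ (-(1:ℝ)/4) * Real.exp (-(t * μ ^ 2) / 2) * Ez t |x - y| := by
  obtain ⟨C, hC, h⟩ := Fz_zero_bound hT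
  refine ⟨C, hC, ?_⟩
  intro t μ x y ht htT hμ hx hy
  obtain ⟨hx0, hx1⟩ := hx
  obtain ⟨hy0, hy1⟩ := hy
  rw [(oneD_hasSum x y ht hμ).tsum_eq]
  have a1 : |x - y| ≤ π := abs_le.mpr ⟨by linarith, by linarith⟩
  have a2 : |x - y| ≤ x + y := abs_le.mpr ⟨by linarith, by linarith⟩
  have a3 : |x - y| ≤ 2 * π - (x + y) := abs_le.mpr ⟨by linarith, by linarith⟩
  have b1 := h t μ |x - y| |x - y| ht htT hμ (abs_nonneg _) le_rfl (by linarith)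
  have b2 := h t μ |x - y| (x + y) ht htT hμ (abs_nonneg _) a2 (by linarith)
  have c1 := (Complex.abs_re_le_norm _).trans b1
  have c2 := (Complex.abs_re_le_norm _).trans b2
  set B := C * t ^ (-(1:ℝ)/4) * Real.exp (-(t * μ ^ 2) / 2) * Ez t |x - y| with hB
  have hB0 : 0 ≤ B := (abs_nonneg _).trans c1
  have hπ := Real.pi_gt_three
  rw [abs_mul, abs_of_nonneg (by positivity)]
  have d : 1 / (2 * π) ≤ 1 / 2 := by
    apply one_div_le_one_div_of_le <;> linarith
  calc _ ≤ (1/2) * (B + B) := by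
        gcongr
        exact (abs_add_le _ _).trans (add_le_add c1 c2)
    _ = B := by ring

lemma pi_summable (g : ℕ → ℝ) (hg0 : ∀ n, 0 ≤ g n) {S : ℝ} (hg : HasSum g S) (m : ℕ) :
    HasSum (fun k : Fin m → ℕ => ∏ l, g (k l)) (S ^ m) := by
  induction m with
  | zero =>
    simp only [Finset.univ_eq_empty, Finset.prod_empty, pow_zero]
    exact hasSum_unique (fun _ : Fin 0 → ℕ => (1:ℝ))
  | succ m ih =>
    rw [← (Fin.insertNthEquiv (fun _ => ℕ) (0 : Fin (m+1))).hasSum_iff, pow_succ']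
    have hs := hg.summable.mul_of_nonneg ih.summable hg0 (fun k => Finset.prod_nonneg fun l _ => hg0 _)
    have := hg.mul ih hs
    refine this.congr_fun fun p => ?_
    simp [Fin.prod_univ_succ]

lemma lam_nonneg {d : ℕ} (k : Fin d → ℕ) : 0 ≤ lam k := Finset.sum_nonneg fun _ _ => sq_nonneg _

lemma exp_lam_le {m : ℕ} {t : ℝ} (ht : 0 < t) (k : Fin m → ℕ) :
    Real.exp (-(t * lam k ^ 2) / 2) ≤ ∏ l, Real.exp (-(t * (k l : ℝ) ^ 4) / 2) := by
  rw [← Real.exp_sum, Real.exp_le_exp]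
  have h : ∑ l, ((k l : ℝ) ^ 2) ^ 2 ≤ (∑ l, (k l : ℝ) ^ 2) ^ 2 :=
    Finset.sum_sq_le_sq_sum_of_nonneg (fun _ _ => sq_nonneg _)
  have h2 : ∑ l, -(t * (k l : ℝ) ^ 4) / 2 = -(t / 2) * ∑ l, ((k l : ℝ) ^ 2) ^ 2 := by
    rw [Finset.mul_sum]; refine Finset.sum_congr rfl fun l _ => by ring
  rw [h2, lam]
  nlinarith [mul_le_mul_of_nonneg_left h ht.le]

lemma multi_sum {T t : ℝ} (ht : 0 < t) (htT : t ≤ T) (m : ℕ) :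
    ∃ (g : (Fin m → ℕ) → ℝ) (S : ℝ), HasSum g S ∧ S ≤ (C0 T 1 * t ^ (-(1:ℝ)/4)) ^ m ∧
      ∀ k, Real.exp (-(t * lam k ^ 2) / 2) ≤ g k := by
  obtain ⟨g, S, hg, hS, hgb⟩ := lattice (R := 1) ht htT zero_le_one
  have hb : ∀ n : ℤ, Real.exp (-(t * (n:ℝ) ^ 4) / 2) ≤ g n := fun n => by
    simpa using hgb n 0 (by simp)
  have g0 : ∀ n, 0 ≤ g n := fun n => (Real.exp_pos _).le.trans (hb n)
  have hinj : Function.Injective (fun n : ℕ => (n : ℤ)) := Nat.cast_injective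
  have hs := hg.summable.comp_injective hinj
  have hle : ∑' n : ℕ, g n ≤ S := by
    rw [← hg.tsum_eq]
    exact _root_.tsum_comp_le_tsum_of_inj hg.summable g0 hinj
  refine ⟨_, _, pi_summable (fun n : ℕ => g n) (fun n => g0 n) hs.hasSum m, ?_, ?_⟩
  · exact pow_le_pow_left₀ (tsum_nonneg fun n : ℕ => g0 (n : ℤ)) (hle.trans hS) m
  · intro k
    refine (exp_lam_le ht k).trans (Finset.prod_le_prod (fun _ _ => (Real.exp_pos _).le) ?_)
    intro l _
    simpa using hb (k l)

lemma epsk_abs_le {d : ℕ} (k : Fin d → ℕ) (x : EuclideanSpace ℝ (Fin d)) : |epsk k x| ≤ 1 := by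
  unfold epsk
  rw [Finset.abs_prod]
  exact Finset.prod_le_one (fun _ _ => abs_nonneg _) fun _ _ => eps1_abs_le _ _

lemma green_summable {d : ℕ} {t : ℝ} (ht : 0 < t) (x y : EuclideanSpace ℝ (Fin d)) :
    Summable (fun k : Fin d → ℕ =>
          Real.exp (-(lam k ^ 2 + lam k) * t) * epsk k x * epsk k y) := by
  obtain ⟨g, S, hg, -, hgb⟩ := multi_sum ht le_rfl d
  refine Summable.of_norm_bounded hg.summable fun k => ?_
  rw [norm_mul, norm_mul, Real.norm_eq_abs, Real.norm_eq_abs, Real.norm_eq_abs, Real.abs_exp]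
  refine le_trans ?_ (hgb k)
  have h1 := epsk_abs_le k x
  have h2 := epsk_abs_le k y
  calc _ ≤ Real.exp (-(lam k ^ 2 + lam k) * t) * 1 * 1 := by gcongr
    _ ≤ _ := by
      rw [mul_one, mul_one, Real.exp_le_exp]
      have := mul_nonneg (lam_nonneg k) ht.le
      have := mul_nonneg (sq_nonneg (lam k)) ht.le
      nlinarith

lemma green_bound (m : ℕ) {T : ℝ} (hT : 0 < T) : ∃ C > 0, ∀ t ∈ Set.Ioc (0:ℝ) T,
    ∀ x ∈ domD (m+1), ∀ y ∈ domD (m+1), ∀ i, |green x y t| ≤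
      C * t ^ (-((m+1 : ℕ):ℝ)/4) * Ez t |x i - y i| := by
  obtain ⟨C, hC, h⟩ := oneD_bound hT
  have hC0 := C0_pos hT 1
  refine ⟨C * C0 T 1 ^ m, by positivity, ?_⟩
  rintro t ⟨ht, htT⟩ x hx y hy i
  have hsum := green_summable ht x y
  unfold green
  let e := (Equiv.prodComm _ _).trans (Fin.insertNthEquiv (fun _ => ℕ) i)
  rw [← e.tsum_eq]
  have hsum' := (e.summable_iff.mpr hsum)
  rw [Summable.tsum_prod (f := fun p => Real.exp (-(lam (e p) ^ 2 + lam (e p)) * t) * epsk (e p) x * epsk (e p) y) hsum']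
  let px : (Fin m → ℕ) → EuclideanSpace ℝ (Fin (m+1)) → ℝ := fun k w =>
    ∏ l, eps1 (k l) (w (i.succAbove l))
  have hpx : ∀ k w, |px k w| ≤ 1 := by
    intro k w
    simp only [px]
    rw [Finset.abs_prod]
    exact Finset.prod_le_one (fun _ _ => abs_nonneg _) fun _ _ => eps1_abs_le _ _
  have hin : ∀ (k : Fin m → ℕ), ∑' j : ℕ, (Real.exp (-(lam (e (k, j)) ^ 2 + lam (e (k, j))) * t) *
      epsk (e (k, j)) x * epsk (e (k, j)) y) =
      (px k x * px k y) * ∑' j : ℕ, az t (lam k) j * (eps1 j (x i) * eps1 j (y i)) := by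
    intro k
    rw [← tsum_mul_left]
    refine tsum_congr fun j => ?_
    have e1 : lam (e (k, j)) = (j:ℝ) ^ 2 + lam k := by
      simp [e, lam, Fin.sum_univ_succAbove _ i]
    have e2 : ∀ w, epsk (e (k, j)) w = eps1 j (w i) * px k w := by
      intro w
      simp [e, px, epsk, Fin.prod_univ_succAbove _ i]
    rw [e1, e2, e2, az]
    ring
  simp only [hin]
  obtain ⟨g, S, hg, hS, hgb⟩ := multi_sum ht htT m
  have hE : 0 < Ez t |x i - y i| := Real.exp_pos _
  have := tsum_of_norm_bounded
    (f := fun k => (px k x * px k y) * ∑' j : ℕ, az t (lam k) j * (eps1 j (x i) * eps1 j (y i)))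
    (hg.mul_left (C * t ^ (-(1:ℝ)/4) * Ez t |x i - y i|)) ?_
  · rw [Real.norm_eq_abs] at this
    refine this.trans ?_
    calc _ ≤ C * t ^ (-(1:ℝ)/4) * Ez t |x i - y i| * (C0 T 1 * t ^ (-(1:ℝ)/4)) ^ m := by gcongr
      _ = C * C0 T 1 ^ m * (t ^ (-(1:ℝ)/4)) ^ (m+1) * Ez t |x i - y i| := by ring
      _ = _ := by
        rw [← Real.rpow_natCast (t ^ (-(1:ℝ)/4)), ← Real.rpow_mul ht.le]
        congr 3
        ring
  · intro k
    rw [Real.norm_eq_abs, abs_mul, abs_mul]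
    have b := h t (lam k) (x i) (y i) ht htT (lam_nonneg k) (hx i) (hy i)
    have p1 := hpx k x
    have p2 := hpx k y
    calc _ ≤ 1 * 1 * (C * t ^ (-(1:ℝ)/4) * Real.exp (-(t * lam k ^ 2) / 2) *
          Ez t |x i - y i|) := by gcongr
      _ = C * t ^ (-(1:ℝ)/4) * Ez t |x i - y i| * Real.exp (-(t * lam k ^ 2) / 2) := by ring
      _ ≤ _ := by gcongr; exact hgb k

lemma exists_coord {m : ℕ} (w : EuclideanSpace ℝ (Fin (m+1))) :
    ∃ i, ‖w‖ ≤ (m+1 : ℝ) * |w i| := by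
  obtain ⟨i, -, hi⟩ := Finset.exists_max_image Finset.univ (fun i => |w i|) Finset.univ_nonempty
  refine ⟨i, ?_⟩
  rw [EuclideanSpace.norm_eq]
  apply Real.sqrt_le_iff.mpr
  refine ⟨by positivity, ?_⟩
  calc ∑ j, ‖w j‖ ^ 2 ≤ ∑ j : Fin (m+1), |w i| ^ 2 := by
        refine Finset.sum_le_sum fun j _ => ?_
        rw [Real.norm_eq_abs]
        exact pow_le_pow_left₀ (abs_nonneg _) (hi j (Finset.mem_univ _)) 2
    _ = (m+1 : ℝ) * |w i| ^ 2 := by simp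
    _ ≤ _ := by
      rw [mul_pow]
      have : (m+1 : ℝ) ≤ (m+1 : ℝ) ^ 2 := by
        have : (0:ℝ) ≤ m := Nat.cast_nonneg m
        nlinarith
      gcongr

/-- Gaussian-type upper bound for the Green's function: for every `T > 0` there are
`c₁, c₂ > 0` such that for `t ∈ (0,T]` and `x, y ∈ D`, the series defining `G(x,y,t)`
converges and `|G(x,y,t)| ≤ c₁ t^{−d/4} exp(−c₂ |x−y|^{4/3} t^{−1/3})`. -/
theorem statement3 (d : ℕ) (hd : d = 1 ∨ d = 2 ∨ d = 3) (T : ℝ) (hT : 0 < T) :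
    ∃ c₁ > (0 : ℝ), ∃ c₂ > (0 : ℝ), ∀ t ∈ Set.Ioc (0 : ℝ) T,
      ∀ x ∈ domD d, ∀ y ∈ domD d,
        Summable (fun k : Fin d → ℕ =>
          Real.exp (-(lam k ^ 2 + lam k) * t) * epsk k x * epsk k y) ∧
        |green x y t| ≤
          c₁ * t ^ (-(d : ℝ) / 4) *
            Real.exp (-c₂ * ‖x - y‖ ^ ((4 : ℝ) / 3) * t ^ (-(1 : ℝ) / 3)) := by
  obtain ⟨m, rfl⟩ : ∃ m, d = m + 1 := ⟨d - 1, by omega⟩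
  obtain ⟨C, hC, h⟩ := green_bound m hT
  set c : ℝ := (36:ℝ) ^ (-(1:ℝ)/3) / 2 with hc
  have hcpos : 0 < c := by positivity
  set N : ℝ := (m + 1 : ℝ) ^ ((4:ℝ)/3) with hN
  have hNpos : 0 < N := by positivity
  refine ⟨C, hC, c / N, by positivity, ?_⟩
  intro t ht x hx y hy
  refine ⟨green_summable ht.1 x y, ?_⟩
  obtain ⟨i, hi⟩ := exists_coord (x - y)
  have ht0 := ht.1
  refine (h t ht x hx y hy i).trans ?_
  have hi' : ‖x - y‖ ^ ((4:ℝ)/3) ≤ N * |x i - y i| ^ ((4:ℝ)/3) := by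
    rw [hN, ← Real.mul_rpow (by positivity) (abs_nonneg _)]
    exact Real.rpow_le_rpow (norm_nonneg _) (by simpa using hi) (by norm_num)
  have : Ez t |x i - y i| ≤
      Real.exp (-(c / N) * ‖x - y‖ ^ ((4 : ℝ) / 3) * t ^ (-(1 : ℝ) / 3)) := by
    unfold Ez
    rw [← hc, Real.exp_le_exp]
    apply mul_le_mul_of_nonneg_right _ (by positivity)
    have := mul_le_mul_of_nonneg_left hi' (by positivity : 0 ≤ c / N)
    have e : c / N * (N * |x i - y i| ^ ((4:ℝ)/3)) = c * |x i - y i| ^ ((4:ℝ)/3) := by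
      field_simp
    linarith
  gcongr
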